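/- There is an absolute constant C > 0 such that the following holds. Let G be a finite abelian group, let A, S, T ⊆ G be nonempty with m_G(A+S) ≤ K·m_G(A) and m_G(S+T) ≤ L·m_G(S), and let m ∈ ℕ. Then there is a symmetric set X ⊆ G with 0 ∈ X and X = −X such that m_G(X) ≥ exp(−C·m²·log(2K)·log(2L))·m_G(T) and mX ⊆ S + A − A − S. -/

import Mathlib

open scoped BigOperators Pointwise ENNReal ENat
open Real

namespace Paper

noncomputable section

/-- For `z` on the unit circle, `circNorm z = min {|θ| : z = exp(2πiθ)}`. -/
def circNorm (z : ℂ) : ℝ := |z.arg| / (2 * Real.pi)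

variable {G : Type} [AddCommGroup G]

/-- The (generalised) Bohr set with frequency set `Γ` and width function `δ`. -/
def bohrSet (Γ : Set (AddChar G ℂ)) (δ : AddChar G ℂ → ℝ) : Set G :=
  {x | ∀ γ ∈ Γ, circNorm (γ x) < δ γ}

/-- `(Γ, δ)` generates the family of sets `F` as a Bohr system. -/
def IsBohrGen (Γ : Set (AddChar G ℂ)) (δ : AddChar G ℂ → ℝ) (F : ℝ → Set G) : Prop :=
  (∀ γ ∈ Γ, 0 < δ γ) ∧ ∀ η : ℝ, 0 < η → η ≤ 1 → F η = bohrSet Γ (fun γ => η * δ γ)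

/-- A Bohr system: a family `(B_η)_{η ∈ (0,1]}` of subsets of `G` of the form
`B_η = Bohr(Γ, ηδ)` for some generating pair `(Γ, δ)`. -/
structure BohrSystem (G : Type) [AddCommGroup G] where
  sets : ℝ → Set G
  exists_gen : ∃ Γ δ, IsBohrGen Γ δ sets

/-- The covering number `C(S;T) = min {|X| : S ⊆ X + T}`, valued in `ℕ∞`. -/
def coveringNumber {H : Type} [AddCommGroup H] (S T : Set H) : ℕ∞ :=
  sInf {n : ℕ∞ | ∃ X : Finset H, (X.card : ℕ∞) = n ∧ S ⊆ (X : Set H) + T}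

/-- Auxiliary quantity for the difference covering number, for a fixed target group `H`. -/
def dCovAux (S T : Set G) (H : Type) [AddCommGroup H] : ℕ∞ :=
  ⨅ (φ : G →+ H) (U : Set H) (V : Set H) (_ : S ⊆ φ ⁻¹' U) (_ : φ ⁻¹' (V - V) ⊆ T),
    coveringNumber U V

/-- The difference covering number `C^Δ(S;T)`: the infimum of `C_H(U;V)` over all abelian
groups `H`, homomorphisms `φ : G → H` and sets `U, V ⊆ H` with `S ⊆ φ⁻¹(U)` and
`φ⁻¹(V − V) ⊆ T`. -/
def dCoveringNumber (S T : Set G) : ℕ∞ :=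
  ⨅ (H : Type) (inst : AddCommGroup H), @dCovAux G _ S T H inst

/-- Interpret an extended natural number as a real number. -/
def enatReal (n : ℕ∞) : ℝ := (n.toNat : ℝ)

/-- The dimension of a family of sets: `sup {log₂ C^Δ(F_η; F_{η/2}) : η ∈ (0,1]}`. -/
def dimOfSets (F : ℝ → Set G) : ℝ :=
  sSup {r : ℝ | ∃ η : ℝ, 0 < η ∧ η ≤ 1 ∧
    r = Real.logb 2 (enatReal (dCoveringNumber (F η) (F (η / 2))))}

/-- The dimension `dim B` of a Bohr system. -/
def BohrSystem.dim (B : BohrSystem G) : ℝ := dimOfSets B.sets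

/-- The doubling dimension of a family of sets:
`sup {log₂ C(F_η; F_{η/2}) : η ∈ (0,1]}`. -/
def dimStarOfSets (F : ℝ → Set G) : ℝ :=
  sSup {r : ℝ | ∃ η : ℝ, 0 < η ∧ η ≤ 1 ∧
    r = Real.logb 2 (enatReal (coveringNumber (F η) (F (η / 2))))}

/-- The doubling dimension `dim* B` of a Bohr system. -/
def BohrSystem.dimStar (B : BohrSystem G) : ℝ := dimStarOfSets B.sets

/-- `B' ≤ B` for Bohr systems, i.e. `B' ∧ B = B'`, i.e. `B'_η ⊆ B_η` for all `η ∈ (0,1]`. -/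
def BohrSystem.le (B' B : BohrSystem G) : Prop :=
  ∀ η : ℝ, 0 < η → η ≤ 1 → B'.sets η ⊆ B.sets η

/-- The width of a Bohr system: `inf {‖δ‖_{ℓ∞(Γ)} : (Γ,δ) generates B}`. -/
def BohrSystem.width (B : BohrSystem G) : ℝ :=
  sInf {r : ℝ | ∃ Γ δ, IsBohrGen Γ δ B.sets ∧ r = sSup (δ '' Γ)}

/-- The `n`-fold sumset `nS = S + ⋯ + S`. -/
def iterSum : ℕ → Set G → Set G
  | 0, _ => {0}
  | n + 1, S => S + iterSum n S

/-- The set of all cosets of subgroups of `G`. -/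
def cosets (G : Type) [AddCommGroup G] : Set (Set G) :=
  {W | ∃ (H : AddSubgroup G) (x : G), W = (fun h => x + h) '' (H : Set G)}

/-- The set of cosets of a fixed subgroup `H` of `G`. -/
def cosetsOf (H : AddSubgroup G) : Set (Set G) :=
  {W | ∃ x : G, W = (fun h => x + h) '' (H : Set G)}

/-- `f` is `ε`-almost integer-valued, with integer part `fZ`. -/
def AlmostInt (ε : ℝ) (f : G → ℂ) (fZ : G → ℤ) : Prop :=
  ∀ x, ‖f x - (fZ x : ℂ)‖ ≤ ε

/-- The `ρ`-approximate annihilator `N(S,ρ)` of a set `S ⊆ G`. -/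
def annihilator (S : Set G) (ρ : ℝ) : Set (AddChar G ℂ) :=
  {γ | ∀ x ∈ S, ‖(1 : ℂ) - γ x‖ < ρ}

/-- `A` is `(m,l)`-arithmetically connected. -/
def ArithConnected (m l : ℕ) (A : Set G) : Prop :=
  ∀ x : Fin m → G, (∀ i, x i ∈ A) →
    ∃ σ : Fin m → ℤ, (∑ i, (σ i).natAbs) ≤ l ∧
      (∃ i j, i ≠ j ∧ (σ i).natAbs = 1 ∧ (σ j).natAbs = 1) ∧
      (∑ i, σ i • x i) ∈ A

variable [Fintype G]

/-- The Haar probability measure of a subset of the finite group `G`. -/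
def haar (S : Set G) : ℝ := (Nat.card S : ℝ) / (Fintype.card G : ℝ)

/-- A probability measure on the finite group `G`, given by its weight function. -/
def IsProb (w : G → ℝ) : Prop := (∀ x, 0 ≤ w x) ∧ ∑ x, w x = 1

/-- The measure of `S` under the weight function `w`. -/
def wMeasure (w : G → ℝ) (S : Set G) : ℝ := ∑ x, S.indicator w x

/-- The probability measure `μ_S`: `μ` restricted to `S` and normalised. -/
def restrictProb (w : G → ℝ) (S : Set G) : G → ℝ :=
  fun x => S.indicator w x / wMeasure w S

/-- The probability measure `w` is `F`-approximately invariant: for every `η ∈ (0,1]` there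
are probability measures `w⁺, w⁻` with `(1−η)·w⁻ ≤ τ_x(w) ≤ (1+η)·w⁺` for all `x ∈ F η`. -/
def ApproxInvariant (F : ℝ → Set G) (w : G → ℝ) : Prop :=
  ∀ η : ℝ, 0 < η → η ≤ 1 → ∃ wp wm : G → ℝ, IsProb wp ∧ IsProb wm ∧
    ∀ x ∈ F η, ∀ y : G, (1 - η) * wm y ≤ w (y - x) ∧ w (y - x) ≤ (1 + η) * wp y

/-- The Fourier coefficient `f̂(γ) = (1/|G|) ∑_x f(x) conj(γ(x))`. -/
def fourierCoeff (f : G → ℂ) (γ : AddChar G ℂ) : ℂ :=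
  (Fintype.card G : ℂ)⁻¹ * ∑ x, f x * (starRingEnd ℂ) (γ x)

/-- The Wiener norm `‖f‖_{A(G)} = ∑_γ |f̂(γ)|`. -/
def wienerNorm (f : G → ℂ) : ℝ := ∑ᶠ γ : AddChar G ℂ, ‖fourierCoeff f γ‖

/-- The Fourier transform `μ̂(γ) = ∫ conj(γ(x)) dμ(x)` of a measure with weight `w`. -/
def fourierWeight (w : G → ℝ) (γ : AddChar G ℂ) : ℂ :=
  ∑ x, (starRingEnd ℂ) (γ x) * (w x : ℂ)

/-- Convolution `f ∗ μ (x) = ∫ f(x−y) dμ(y)` of a complex function with a measure. -/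
def convC (f : G → ℂ) (w : G → ℝ) (x : G) : ℂ := ∑ y, f (x - y) * (w y : ℂ)

/-- Convolution `f ∗ μ (x) = ∫ f(x−y) dμ(y)` of a real function with a measure. -/
def convR (f : G → ℝ) (w : G → ℝ) (x : G) : ℝ := ∑ y, f (x - y) * w y

/-- Convolution of functions w.r.t. Haar measure: `f ∗ g (x) = (1/|G|) ∑_y f(y) g(x−y)`. -/
def convFun (f g : G → ℝ) (x : G) : ℝ := (Fintype.card G : ℝ)⁻¹ * ∑ y, f y * g (x - y)

/-- The `L_p` norm `(∫ |f|^p dν)^{1/p}` w.r.t. the measure with weight `w`. -/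
def LpW (p : ℝ) (w : G → ℝ) (f : G → ℂ) : ℝ := (∑ y, w y * ‖f y‖ ^ p) ^ (1 / p)

/-- `X` has relative polynomial growth of order `d`. -/
def HasRPG (X : Set G) (d : ℝ) : Prop :=
  ∀ n : ℕ, 1 ≤ n → haar (iterSum n X) ≤ (n : ℝ) ^ d * haar X

end

section helpers

lemma pow_le_cosh (x : ℝ) (q : ℕ) (hq : 1 ≤ q) :
    x ^ (2 * q) ≤ (2 * q).factorial * (Real.cosh x - 1) := by
  have h := Real.hasSum_cosh x
  have h2 := sum_le_hasSum ({0, q} : Finset ℕ) (fun i _ => by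
    have : 0 ≤ x ^ (2 * i) := by rw [pow_mul]; positivity
    positivity) h
  rw [Finset.sum_pair (by omega)] at h2
  simp at h2
  have hf : (0 : ℝ) < (2 * q).factorial := by positivity
  have : x ^ (2 * q) / (2 * q).factorial ≤ Real.cosh x - 1 := by linarith
  rw [div_le_iff₀ hf] at this
  linarith

lemma sum_exp_pi {G : Type} [DecidableEq G] (S : Finset G) (k : ℕ) (f : G → ℝ) :
    ∑ s ∈ Fintype.piFinset (fun _ : Fin k => S), Real.exp (∑ i, f (s i)) =
      (∑ u ∈ S, Real.exp (f u)) ^ k := by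
  simp_rw [Real.exp_sum]
  rw [← Finset.prod_univ_sum (fun _ : Fin k => S) (fun _ u => Real.exp (f u))]
  simp

lemma sum_exp_ind {G : Type} (S : Finset G) (hS : S.Nonempty) (b : G → ℝ)
    (hb : ∀ u, b u = 0 ∨ b u = 1) (l : ℝ) :
    ∑ u ∈ S, Real.exp (l * b u) =
      S.card * (1 + ((∑ u ∈ S, b u) / S.card) * (Real.exp l - 1)) := by
  have h : ∀ u, Real.exp (l * b u) = 1 + b u * (Real.exp l - 1) := by
    intro u
    rcases hb u with h | h <;> simp [h]
  have hc : (S.card : ℝ) ≠ 0 := by simpa using hS.ne_empty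
  simp_rw [h]
  rw [Finset.sum_add_distrib, ← Finset.sum_mul]
  field_simp
  simp

lemma moment {G : Type} [DecidableEq G] (S : Finset G) (hS : S.Nonempty) (b : G → ℝ)
    (hb : ∀ u, b u = 0 ∨ b u = 1) (k q : ℕ) (hq : 1 ≤ q) (hk : 1 ≤ k) :
    ∑ s' ∈ Fintype.piFinset (fun _ : Fin k => S), ∑ s ∈ Fintype.piFinset (fun _ : Fin k => S),
      (∑ i, b (s i) - ∑ i, b (s' i)) ^ (2 * q) ≤
      (S.card : ℝ) ^ (2 * k) * (2 * Real.exp 1 * q * k) ^ q *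
        (2 * ((∑ u ∈ S, b u) / S.card)) := by
  set P := Fintype.piFinset (fun _ : Fin k => S) with hP
  set β := (∑ u ∈ S, b u) / S.card with hβ
  have hc : (0 : ℝ) < S.card := by exact_mod_cast hS.card_pos
  have hb0 : ∀ u, 0 ≤ b u := fun u => by rcases hb u with h | h <;> simp [h]
  have hb1 : ∀ u, b u ≤ 1 := fun u => by rcases hb u with h | h <;> simp [h]
  have hβ0 : 0 ≤ β := div_nonneg (Finset.sum_nonneg fun u _ => hb0 u) hc.le
  have hβ1 : β ≤ 1 := by
    rw [hβ, div_le_one hc]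
    calc _ ≤ ∑ u ∈ S, (1 : ℝ) := Finset.sum_le_sum fun u _ => hb1 u
      _ = _ := by simp
  have hqR : (1 : ℝ) ≤ q := by exact_mod_cast hq
  have hkR : (1 : ℝ) ≤ k := by exact_mod_cast hk
  -- exponential moments
  have hexp : ∀ l : ℝ, ∑ s' ∈ P, ∑ s ∈ P, Real.exp (l * (∑ i, b (s i) - ∑ i, b (s' i))) =
      (S.card : ℝ) ^ (2 * k) * (1 + 2 * β * (1 - β) * (Real.cosh l - 1)) ^ k := by
    intro l
    have e1 : ∀ s s' : Fin k → G, Real.exp (l * (∑ i, b (s i) - ∑ i, b (s' i))) =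
        Real.exp (∑ i, l * b (s i)) * Real.exp (∑ i, (-l) * b (s' i)) := by
      intro s s'
      rw [← Real.exp_add, ← Finset.mul_sum, ← Finset.mul_sum]
      congr 1; ring
    simp_rw [e1]
    simp_rw [← Finset.sum_mul]
    rw [← Finset.mul_sum, sum_exp_pi S k (fun u => l * b u), sum_exp_pi S k (fun u => (-l) * b u),
      sum_exp_ind S hS b hb, sum_exp_ind S hS b hb, ← hβ, mul_pow, mul_pow, two_mul, pow_add,
      mul_mul_mul_comm, ← mul_pow (1 + _)]
    congr 2
    rw [Real.cosh_eq]
    have : Real.exp l * Real.exp (-l) = 1 := by rw [← Real.exp_add]; simp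
    linear_combination β ^ 2 * this
  have hcosh : ∀ l : ℝ, ∑ s' ∈ P, ∑ s ∈ P, (Real.cosh (l * (∑ i, b (s i) - ∑ i, b (s' i))) - 1) =
      (S.card : ℝ) ^ (2 * k) * ((1 + 2 * β * (1 - β) * (Real.cosh l - 1)) ^ k - 1) := by
    intro l
    have h1 := hexp l
    have h2 := hexp (-l)
    rw [Real.cosh_neg] at h2
    have hcard : ((P.card : ℕ) : ℝ) = (S.card : ℝ) ^ k := by simp [hP]
    simp_rw [Real.cosh_eq (l * _), Finset.sum_sub_distrib, ← Finset.sum_div,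
      Finset.sum_add_distrib]
    simp_rw [neg_mul] at h2
    rw [h1, h2]
    simp [hcard]
    ring
  set l := Real.sqrt (2 * q / k) with hl
  have hl2 : l ^ 2 = 2 * q / k := Real.sq_sqrt (by positivity)
  have hl0 : 0 < l := Real.sqrt_pos.2 (by positivity)
  set r := 2 * β * (1 - β) with hr
  have hr0 : 0 ≤ r := by have := sub_nonneg.2 hβ1; positivity
  have hr1 : r ≤ 1 := by nlinarith [sq_nonneg (2 * β - 1)]
  have hr2 : r ≤ 2 * β := by nlinarith
  have hw : (1 + r * (Real.cosh l - 1)) ^ k - 1 ≤ r * Real.exp q := by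
    have hcx := (convexOn_pow (𝕜 := ℝ) k).2 (x := 1) (by simp) (y := Real.cosh l)
      (by simpa using (Real.cosh_pos l).le) (sub_nonneg.2 hr1) hr0 (by ring)
    simp only [smul_eq_mul, one_pow, mul_one] at hcx
    have h3 : Real.cosh l ^ k ≤ Real.exp q := by
      calc Real.cosh l ^ k ≤ Real.exp (l ^ 2 / 2) ^ k :=
            pow_le_pow_left₀ (Real.cosh_pos l).le (Real.cosh_le_exp_half_sq l) k
        _ = Real.exp q := by
            rw [← Real.exp_nat_mul, hl2]; congr 1; field_simp
    have h4 : (1 + r * (Real.cosh l - 1)) = 1 - r + r * Real.cosh l := by ring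
    rw [h4]
    nlinarith [mul_le_mul_of_nonneg_left h3 hr0]
  have hmain : l ^ (2 * q) * ∑ s' ∈ P, ∑ s ∈ P, (∑ i, b (s i) - ∑ i, b (s' i)) ^ (2 * q) ≤
      (2 * q).factorial * ((S.card : ℝ) ^ (2 * k) * (r * Real.exp q)) := by
    calc _ = ∑ s' ∈ P, ∑ s ∈ P, (l * (∑ i, b (s i) - ∑ i, b (s' i))) ^ (2 * q) := by
          simp_rw [Finset.mul_sum, mul_pow]
      _ ≤ ∑ s' ∈ P, ∑ s ∈ P, (2 * q).factorial *
            (Real.cosh (l * (∑ i, b (s i) - ∑ i, b (s' i))) - 1) :=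
          Finset.sum_le_sum fun s' _ => Finset.sum_le_sum fun s _ => pow_le_cosh _ q hq
      _ = (2 * q).factorial * ((S.card : ℝ) ^ (2 * k) *
            ((1 + r * (Real.cosh l - 1)) ^ k - 1)) := by
          rw [← hcosh]; simp_rw [Finset.mul_sum]
      _ ≤ _ := by gcongr
  have hfac : ((2 * q).factorial : ℝ) ≤ (2 * q : ℝ) ^ (2 * q) := by
    exact_mod_cast Nat.factorial_le_pow (2 * q)
  have hlq : l ^ (2 * q) * (2 * Real.exp 1 * q * k) ^ q = (2 * q : ℝ) ^ (2 * q) * Real.exp q := by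
    have : Real.exp q = Real.exp 1 ^ q := by rw [← Real.exp_nat_mul]; simp
    rw [this, pow_mul, pow_mul, ← mul_pow, ← mul_pow, hl2]
    congr 1; field_simp
  have hlp : 0 < l ^ (2 * q) := by positivity
  refine le_of_mul_le_mul_left (hmain.trans ?_) hlp
  calc _ ≤ (2 * q : ℝ) ^ (2 * q) * ((S.card : ℝ) ^ (2 * k) * (2 * β * Real.exp q)) := by gcongr
    _ = (S.card : ℝ) ^ (2 * k) * (2 * β) * ((2 * q : ℝ) ^ (2 * q) * Real.exp q) := by ring
    _ = _ := by rw [← hlq]; ring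

end helpers

section helpers2

/-- Unnormalised empirical count of the translates of `B` along the sample `s`. -/
noncomputable def smp {G : Type} [AddCommGroup G] [DecidableEq G] (B : Finset G) {k : ℕ}
    (s : Fin k → G) (y : G) : ℝ :=
  ∑ i, if y + s i ∈ B then (1 : ℝ) else 0

lemma sampling {G : Type} [AddCommGroup G] [Fintype G] [DecidableEq G] (S B : Finset G)
    (hS : S.Nonempty) (k q : ℕ) (hq : 1 ≤ q) (hk : 1 ≤ k) :
    ∃ s' ∈ Fintype.piFinset (fun _ : Fin k => S),
      ∑ s ∈ Fintype.piFinset (fun _ : Fin k => S), ∑ y, (smp B s y - smp B s' y) ^ (2 * q) ≤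
      (S.card : ℝ) ^ k * ((2 * Real.exp 1 * q * k) ^ q * (2 * B.card)) := by
  set P := Fintype.piFinset (fun _ : Fin k => S) with hP
  have hPne : P.Nonempty := by
    obtain ⟨u, hu⟩ := hS
    exact ⟨fun _ => u, by simp [hP, hu]⟩
  have hc : (0 : ℝ) < S.card := by exact_mod_cast hS.card_pos
  have hcard : ((P.card : ℕ) : ℝ) = (S.card : ℝ) ^ k := by simp [hP]
  apply Finset.exists_le_of_sum_le hPne
  rw [Finset.sum_const, nsmul_eq_mul, hcard]
  have hβ : ∑ y : G, ((∑ u ∈ S, if y + u ∈ B then (1 : ℝ) else 0) / S.card) = B.card := by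
    rw [← Finset.sum_div, Finset.sum_comm]
    have : ∀ u ∈ S, ∑ y : G, (if y + u ∈ B then (1 : ℝ) else 0) = B.card := by
      intro u _
      have h := Equiv.sum_comp (Equiv.addRight u) (fun y => if y ∈ B then (1 : ℝ) else 0)
      simp only [Equiv.coe_addRight] at h
      exact h.trans (by simp)
    rw [Finset.sum_congr rfl this]
    simp
    field_simp
  calc _ = ∑ y : G, ∑ s' ∈ P, ∑ s ∈ P, (smp B s y - smp B s' y) ^ (2 * q) := by
        rw [Finset.sum_comm (s := (Finset.univ : Finset G))]
        refine Finset.sum_congr rfl fun s' _ => ?_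
        rw [Finset.sum_comm]
    _ ≤ ∑ y : G, (S.card : ℝ) ^ (2 * k) * (2 * Real.exp 1 * q * k) ^ q *
        (2 * ((∑ u ∈ S, if y + u ∈ B then (1 : ℝ) else 0) / S.card)) :=
        Finset.sum_le_sum fun y _ => moment S hS (fun u => if y + u ∈ B then (1 : ℝ) else 0)
          (fun u => by by_cases h : y + u ∈ B <;> simp [h]) k q hq hk
    _ = _ := by
        rw [← Finset.mul_sum, ← Finset.mul_sum, hβ]; ring

lemma markov {α : Type} (P : Finset α) (f : α → ℝ) (hf : ∀ a ∈ P, 0 ≤ f a) (c : ℝ) (hc : 0 < c)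
    (h : ∑ a ∈ P, f a ≤ P.card * c) :
    (P.card : ℝ) ≤ 2 * (P.filter (fun a => f a ≤ 2 * c)).card := by
  have h1 : (P.card : ℝ) = (P.filter (fun a => f a ≤ 2 * c)).card +
      (P.filter (fun a => ¬ f a ≤ 2 * c)).card := by
    exact_mod_cast (Finset.card_filter_add_card_filter_not (s := P) (fun a => f a ≤ 2 * c)).symm
  have h2 : ((P.filter (fun a => ¬ f a ≤ 2 * c)).card : ℝ) * (2 * c) ≤ ∑ a ∈ P, f a := by
    calc _ = ∑ a ∈ P.filter (fun a => ¬ f a ≤ 2 * c), 2 * c := by simp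
      _ ≤ ∑ a ∈ P.filter (fun a => ¬ f a ≤ 2 * c), f a :=
        Finset.sum_le_sum fun a ha => (not_le.1 (Finset.mem_filter.1 ha).2).le
      _ ≤ _ := Finset.sum_le_sum_of_subset_of_nonneg (Finset.filter_subset _ _)
        fun a ha _ => hf a ha
  have h3 : ((P.filter (fun a => ¬ f a ≤ 2 * c)).card : ℝ) * 2 ≤ P.card := by
    refine le_of_mul_le_mul_right ?_ hc
    linarith
  linarith

lemma pigeon {G : Type} [AddCommGroup G] [Fintype G] [DecidableEq G] (S T : Finset G) (k : ℕ)
    (hS : S.Nonempty) (hT : T.Nonempty)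
    (Q : Finset (Fin k → G)) (hQ : Q ⊆ Fintype.piFinset (fun _ : Fin k => S)) :
    ∃ (z : Fin k → G) (T' : Finset G), T' ⊆ T ∧ (∀ t ∈ T', (fun i => z i - t) ∈ Q) ∧
      (Q.card : ℝ) * T.card ≤ ((S + T).card : ℝ) ^ k * T'.card := by
  set R := Fintype.piFinset (fun _ : Fin k => S + T) with hR
  have hRne : R.Nonempty := by
    obtain ⟨u, hu⟩ := hS
    obtain ⟨v, hv⟩ := hT
    exact ⟨fun _ => u + v, by simpa [hR] using fun _ => Finset.add_mem_add hu hv⟩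
  have hcard : ((R.card : ℕ) : ℝ) = ((S + T).card : ℝ) ^ k := by simp [hR]
  have hmaps : ∀ p ∈ Q ×ˢ T, (fun p : (Fin k → G) × G => fun i => p.1 i + p.2) p ∈ R := by
    intro p hp
    rw [Finset.mem_product] at hp
    have := hQ hp.1
    simp only [Fintype.mem_piFinset, hR] at this ⊢
    exact fun i => Finset.add_mem_add (this i) hp.2
  have hcnt := Finset.card_eq_sum_card_fiberwise hmaps
  have hle : ∑ z ∈ R, ((Q.card : ℝ) * T.card / R.card) ≤
      ∑ z ∈ R, (((Q ×ˢ T).filter (fun p => (fun i => p.1 i + p.2) = z)).card : ℝ) := by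
    rw [← Nat.cast_sum, ← hcnt]
    have : (R.card : ℝ) ≠ 0 := by simpa using hRne.ne_empty
    simp
    field_simp
    rfl
  obtain ⟨z, hz, hz2⟩ := Finset.exists_le_of_sum_le hRne hle
  refine ⟨z, T.filter (fun t => (fun i => z i - t) ∈ Q), Finset.filter_subset _ _,
    fun t ht => (Finset.mem_filter.1 ht).2, ?_⟩
  have hRp : (0 : ℝ) < R.card := by exact_mod_cast hRne.card_pos
  rw [div_le_iff₀ hRp, hcard, mul_comm] at hz2
  rw [mul_comm]
  rw [mul_comm] at hz2
  refine (mul_comm (Q.card : ℝ) _ ▸ hz2).trans ?_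
  rw [mul_comm]
  gcongr
  refine Finset.card_le_card_of_injOn Prod.snd ?_ ?_
  · rintro ⟨s, t⟩ hp
    simp only [Finset.coe_filter, Finset.mem_product, Set.mem_ofPred_eq] at hp ⊢
    refine ⟨hp.1.2, ?_⟩
    have : (fun i => z i - t) = s := by
      rw [← hp.2]; ext i; simp
    rw [this]; exact hp.1.1
  · rintro ⟨s, t⟩ hp ⟨s2, t2⟩ hp2 h
    simp only [Finset.coe_filter, Finset.mem_product, Set.mem_ofPred_eq] at hp hp2 h
    subst h
    have := hp.2.trans hp2.2.symm
    congr 1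
    ext i
    simpa using congrFun this i

lemma convex_step (n q : ℕ) (u v : ℝ) :
    (u + v) ^ (2 * q) ≤
      ((n : ℝ) + 2) ^ (2 * q) * ((n + 1) / (n + 2) * (u / (n + 1)) ^ (2 * q)
        + 1 / (n + 2) * v ^ (2 * q)) := by
  have hn1 : (0 : ℝ) < n + 1 := by positivity
  have hn2 : (0 : ℝ) < n + 2 := by positivity
  have hcv : ConvexOn ℝ Set.univ (fun x : ℝ => x ^ (2 * q)) := Even.convexOn_pow (by simp)
  have h := hcv.2 (Set.mem_univ (u / ((n : ℝ) + 1))) (Set.mem_univ v)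
    (by positivity : 0 ≤ ((n : ℝ) + 1) / (n + 2)) (by positivity : 0 ≤ 1 / ((n : ℝ) + 2))
    (by field_simp; ring)
  simp only [smul_eq_mul] at h
  have e : u + v = (n + 2) * (((n : ℝ) + 1) / (n + 2) * (u / (n + 1)) + 1 / ((n : ℝ) + 2) * v) := by
    field_simp
  rw [e, mul_pow]
  gcongr

lemma iter_bound {G : Type} [AddCommGroup G] [Fintype G] (F : G → ℝ) (q : ℕ) (D : ℝ) (X : Set G)
    (hX : ∀ x ∈ X, ∑ y, (F (y + x) - F y) ^ (2 * q) ≤ D) (n : ℕ) :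
    ∀ x ∈ iterSum (n + 1) X, ∑ y, (F (y + x) - F y) ^ (2 * q) ≤ ((n : ℝ) + 1) ^ (2 * q) * D := by
  induction n with
  | zero =>
    intro x hx
    simp only [iterSum, Set.add_singleton, add_zero] at hx
    simpa using hX x (by simpa using hx)
  | succ n ih =>
    intro x hx
    obtain ⟨a, ha, w, hw, rfl⟩ := hx
    have h1 := ih w hw
    have h2 := hX a ha
    have h2' : ∑ y, (F (y + w + a) - F (y + w)) ^ (2 * q) ≤ D := by
      have h := Equiv.sum_comp (Equiv.addRight w) (fun y => (F (y + a) - F y) ^ (2 * q))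
      simp only [Equiv.coe_addRight] at h
      rw [h]
      exact h2
    have hn1 : (0 : ℝ) < n + 1 := by positivity
    have hn2 : (0 : ℝ) < n + 2 := by positivity
    calc ∑ y, (F (y + (a + w)) - F y) ^ (2 * q)
        ≤ ∑ y, ((n : ℝ) + 2) ^ (2 * q) * ((n + 1) / (n + 2) *
            ((F (y + w) - F y) / (n + 1)) ^ (2 * q)
            + 1 / (n + 2) * (F (y + w + a) - F (y + w)) ^ (2 * q)) := by
          refine Finset.sum_le_sum fun y _ => ?_
          have := convex_step n q (F (y + w) - F y) (F (y + w + a) - F (y + w))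
          have e : F (y + (a + w)) - F y = F (y + w) - F y + (F (y + w + a) - F (y + w)) := by
            rw [show y + (a + w) = y + w + a by abel]; ring
          rw [e]; exact this
      _ = ((n : ℝ) + 2) ^ (2 * q) * ((n + 1) / (n + 2) *
            ((∑ y, (F (y + w) - F y) ^ (2 * q)) / (n + 1) ^ (2 * q))
            + 1 / (n + 2) * ∑ y, (F (y + w + a) - F (y + w)) ^ (2 * q)) := by
          rw [← Finset.mul_sum, Finset.sum_add_distrib, ← Finset.mul_sum, ← Finset.mul_sum]
          simp_rw [div_pow, Finset.sum_div]
      _ ≤ ((n : ℝ) + 2) ^ (2 * q) * ((n + 1) / (n + 2) * D + 1 / (n + 2) * D) := by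
          gcongr
          rw [div_le_iff₀ (by positivity)]
          linarith
      _ = _ := by
          push_cast
          have : ((n : ℝ) + 1) / (n + 2) * D + 1 / (n + 2) * D = D := by field_simp; ring
          rw [this]; ring

end helpers2

section helpers3

lemma smp_shift {G : Type} [AddCommGroup G] [DecidableEq G] (B : Finset G) {k : ℕ}
    (z : Fin k → G) (y t : G) : smp B (fun i => z i - t) (y + t) = smp B z y := by
  unfold smp
  refine Finset.sum_congr rfl fun i _ => ?_
  rw [show y + t + (z i - t) = y + z i by abel]

lemma core {G : Type} [AddCommGroup G] [Fintype G] [DecidableEq G] (A S T : Finset G)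
    (hA : A.Nonempty) (hS : S.Nonempty) (hT : T.Nonempty) (K L : ℝ) (m k q : ℕ)
    (hm : 1 ≤ m) (hk : 1 ≤ k) (hq : 1 ≤ q)
    (hK : ((A + S).card : ℝ) ≤ K * A.card) (hL : ((S + T).card : ℝ) ≤ L * S.card)
    (hnum : (8 * Real.exp 1 * q * k * m ^ 2) ^ q * (4 * K) < (k : ℝ) ^ (2 * q)) :
    ∃ X : Finset G, (0 : G) ∈ X ∧ X = -X ∧ (T.card : ℝ) ≤ 2 * L ^ k * X.card ∧
      iterSum m (X : Set G) ⊆ (S : Set G) + A - A - S := by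
  set B := A + S with hB
  obtain ⟨s', hs', hsum⟩ := sampling S B hS k q hq hk
  set P := Fintype.piFinset (fun _ : Fin k => S) with hP
  set F : G → ℝ := smp B s' with hF
  have hBne : B.Nonempty := hA.add hS
  have hBpos : (0 : ℝ) < B.card := by exact_mod_cast hBne.card_pos
  have hSpos : (0 : ℝ) < S.card := by exact_mod_cast hS.card_pos
  have hApos : (0 : ℝ) < A.card := by exact_mod_cast hA.card_pos
  have hTpos : (0 : ℝ) < T.card := by exact_mod_cast hT.card_pos
  have hqR : (1 : ℝ) ≤ q := by exact_mod_cast hq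
  have hkR : (1 : ℝ) ≤ k := by exact_mod_cast hk
  have hpow : ∀ x : ℝ, 0 ≤ x ^ (2 * q) := fun x => by rw [pow_mul]; positivity
  set c : ℝ := (2 * Real.exp 1 * q * k) ^ q * (2 * B.card) with hc
  have hcpos : 0 < c := by positivity
  have hcard : ((P.card : ℕ) : ℝ) = (S.card : ℝ) ^ k := by simp [hP]
  have hmk := markov P (fun s => ∑ y, (smp B s y - F y) ^ (2 * q))
    (fun s _ => Finset.sum_nonneg fun y _ => hpow _) c hcpos (by rw [hcard]; exact hsum)
  set Q := P.filter (fun s => ∑ y, (smp B s y - F y) ^ (2 * q) ≤ 2 * c) with hQ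
  obtain ⟨z, T', hT'T, hT'Q, hT'card⟩ := pigeon S T k hS hT Q (Finset.filter_subset _ _)
  -- size
  have hsize : (T.card : ℝ) ≤ 2 * L ^ k * T'.card := by
    rw [hcard] at hmk
    have h1 : ((S + T).card : ℝ) ^ k ≤ L ^ k * (S.card : ℝ) ^ k := by
      rw [← mul_pow]; exact pow_le_pow_left₀ (by positivity) hL k
    have hSk : (0 : ℝ) < (S.card : ℝ) ^ k := by positivity
    refine le_of_mul_le_mul_left ?_ hSk
    calc (S.card : ℝ) ^ k * T.card ≤ 2 * Q.card * T.card := by gcongr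
      _ = 2 * (Q.card * T.card) := by ring
      _ ≤ 2 * (((S + T).card : ℝ) ^ k * T'.card) := by gcongr
      _ ≤ 2 * ((L ^ k * (S.card : ℝ) ^ k) * T'.card) := by gcongr
      _ = _ := by ring
  have hT'ne : T'.Nonempty := by
    rw [← Finset.card_pos]
    by_contra h
    have : T'.card = 0 := by omega
    rw [this] at hsize
    simp at hsize
    exact hT.ne_empty hsize
  have hgood : ∀ t ∈ T', ∑ y, (smp B z y - F (y + t)) ^ (2 * q) ≤ 2 * c := by
    intro t ht
    have h := (Finset.mem_filter.1 (hT'Q t ht)).2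
    have e := Equiv.sum_comp (Equiv.addRight t)
      (fun y => (smp B (fun i => z i - t) y - F y) ^ (2 * q))
    simp only [Equiv.coe_addRight, smp_shift] at e
    rw [e]; exact h
  have hD : ∀ x ∈ ((T' - T' : Finset G) : Set G),
      ∑ y, (F (y + x) - F y) ^ (2 * q) ≤ 2 ^ (2 * q) * (2 * c) := by
    intro x hx
    obtain ⟨t1, ht1, t2, ht2, rfl⟩ := Finset.mem_sub.1 (Finset.mem_coe.1 hx)
    have e := Equiv.sum_comp (Equiv.addRight t2)
      (fun y => (F (y + (t1 - t2)) - F y) ^ (2 * q))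
    simp only [Equiv.coe_addRight] at e
    rw [← e]
    have g1 := hgood t1 ht1
    have g2 := hgood t2 ht2
    calc ∑ y, (F (y + t2 + (t1 - t2)) - F (y + t2)) ^ (2 * q)
        ≤ ∑ y, 2 ^ (2 * q) * (1 / 2 * (smp B z y - F (y + t1)) ^ (2 * q)
            + 1 / 2 * (smp B z y - F (y + t2)) ^ (2 * q)) := by
          refine Finset.sum_le_sum fun y _ => ?_
          have h := convex_step 0 q (-(smp B z y - F (y + t1))) (smp B z y - F (y + t2))
          have hev : (-(smp B z y - F (y + t1))) ^ (2 * q) = (smp B z y - F (y + t1)) ^ (2 * q) :=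
            Even.neg_pow (by simp) _
          simp only [Nat.cast_zero, zero_add, div_one, hev] at h
          rw [show y + t2 + (t1 - t2) = y + t1 by abel]
          rw [show F (y + t1) - F (y + t2) =
            -(smp B z y - F (y + t1)) + (smp B z y - F (y + t2)) by ring]
          exact h
      _ = 2 ^ (2 * q) * (1 / 2 * ∑ y, (smp B z y - F (y + t1)) ^ (2 * q)
            + 1 / 2 * ∑ y, (smp B z y - F (y + t2)) ^ (2 * q)) := by
          rw [← Finset.mul_sum, Finset.sum_add_distrib, ← Finset.mul_sum, ← Finset.mul_sum]
      _ ≤ _ := by gcongr; linarith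
  refine ⟨T' - T', ?_, ?_, ?_, ?_⟩
  · obtain ⟨t, ht⟩ := hT'ne
    exact Finset.mem_sub.2 ⟨t, ht, t, ht, sub_self t⟩
  · rw [neg_sub]
  · refine hsize.trans ?_
    have hL0 : 0 ≤ L := by
      by_contra h
      have h1 : L * S.card < 0 := mul_neg_of_neg_of_pos (not_le.1 h) hSpos
      have h2 : (0 : ℝ) ≤ ((S + T).card : ℝ) := by positivity
      linarith
    have : T'.card ≤ (T' - T').card := Finset.card_le_card_sub_right hT'ne
    gcongr
  · intro x hx
    obtain ⟨n, rfl⟩ : ∃ n, m = n + 1 := ⟨m - 1, by omega⟩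
    have hb := iter_bound F q _ _ hD n x hx
    by_contra hcon
    have hs'S : ∀ i, s' i ∈ S := by simpa [hP] using hs'
    have hF1 : ∀ a ∈ A, F a = k := by
      intro a ha
      have : ∀ i, a + s' i ∈ B := fun i => Finset.add_mem_add ha (hs'S i)
      simp [hF, smp, this]
    have hF0 : ∀ a ∈ A, F (a + x) = 0 := by
      intro a ha
      have : ∀ i, a + x + s' i ∉ B := by
        intro i hi
        obtain ⟨a2, ha2, u, hu, he⟩ := Finset.mem_add.1 hi
        apply hcon
        refine Set.mem_sub.2 ⟨u + a2 - a, Set.mem_sub.2 ⟨u + a2, Set.mem_add.2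
          ⟨u, hu, a2, ha2, rfl⟩, a, ha, rfl⟩, s' i, hs'S i, ?_⟩
        rw [add_comm u a2, he]; abel
      simp [hF, smp, this]
    have hlow : (A.card : ℝ) * (k : ℝ) ^ (2 * q) ≤ ∑ y, (F (y + x) - F y) ^ (2 * q) := by
      calc _ = ∑ y ∈ A, (F (y + x) - F y) ^ (2 * q) := by
            rw [Finset.sum_congr rfl (g := fun _ => (k : ℝ) ^ (2 * q))]
            · simp
            · intro a ha
              rw [hF1 a ha, hF0 a ha, zero_sub]
              exact Even.neg_pow (by simp) _
        _ ≤ _ := Finset.sum_le_sum_of_subset_of_nonneg (Finset.subset_univ _)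
            fun y _ _ => hpow _
    have hup : ((n : ℝ) + 1) ^ (2 * q) * (2 ^ (2 * q) * (2 * c)) ≤
        A.card * ((8 * Real.exp 1 * q * k * ((n : ℝ) + 1) ^ 2) ^ q * (4 * K)) := by
      calc _ = (8 * Real.exp 1 * q * k * ((n : ℝ) + 1) ^ 2) ^ q * 4 * B.card := by
            rw [hc, pow_mul, pow_mul]
            have : (8 * Real.exp 1 * q * k * ((n : ℝ) + 1) ^ 2) =
              ((n : ℝ) + 1) ^ 2 * 2 ^ 2 * (2 * Real.exp 1 * q * k) := by ring
            rw [this, mul_pow _ (2 * Real.exp 1 * q * k), mul_pow (((n : ℝ) + 1) ^ 2)]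
            ring
        _ ≤ (8 * Real.exp 1 * q * k * ((n : ℝ) + 1) ^ 2) ^ q * 4 * (K * A.card) := by gcongr
        _ = _ := by ring
    push_cast at hnum
    have := mul_lt_mul_of_pos_left hnum hApos
    linarith

lemma haar_coe {G : Type} [AddCommGroup G] [Fintype G] (X : Finset G) :
    haar (X : Set G) = X.card / Fintype.card G := by
  simp [haar]

end helpers3

/-- Proposition 5.7. -/
theorem statement8 :
    ∃ C : ℝ, 0 < C ∧
      ∀ (G : Type) [AddCommGroup G] [Fintype G],
        ∀ (A S T : Set G) (K L : ℝ) (m : ℕ),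
          A.Nonempty → S.Nonempty → T.Nonempty →
          haar (A + S) ≤ K * haar A → haar (S + T) ≤ L * haar S →
          ∃ X : Set G, (0 : G) ∈ X ∧ X = -X ∧
            Real.exp (-(C * (m : ℝ) ^ 2 * Real.log (2 * K) * Real.log (2 * L))) * haar T ≤
              haar X ∧
            iterSum m X ⊆ S + A - A - S := by
  classical
  refine ⟨768, by norm_num, ?_⟩
  intro G _ _ A S T K L m hA hS hT hK hL
  have hGpos : (0 : ℝ) < Fintype.card G := by exact_mod_cast Fintype.card_pos
  rcases Nat.eq_zero_or_pos m with rfl | hm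
  · refine ⟨Set.univ, Set.mem_univ _, by simp, ?_, ?_⟩
    · simp only [Nat.cast_zero]
      norm_num
      unfold haar
      gcongr
      exact_mod_cast Nat.card_mono (Set.toFinite _) (Set.subset_univ T)
    · intro x hx
      have hx0 : x = 0 := by simpa [iterSum] using hx
      obtain ⟨a, ha⟩ := hA
      obtain ⟨s, hs⟩ := hS
      refine Set.mem_sub.2 ⟨s + a - a, Set.mem_sub.2 ⟨s + a, Set.add_mem_add hs ha, a, ha, rfl⟩,
        s, hs, ?_⟩
      rw [hx0]; abel
  lift A to Finset G using Set.toFinite A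
  lift S to Finset G using Set.toFinite S
  lift T to Finset G using Set.toFinite T
  rw [Finset.coe_nonempty] at hA hS hT
  rw [← Finset.coe_add, haar_coe, haar_coe, mul_div_assoc', div_le_div_iff_of_pos_right hGpos]
    at hK hL
  have hSpos : (0 : ℝ) < S.card := by exact_mod_cast hS.card_pos
  have hApos : (0 : ℝ) < A.card := by exact_mod_cast hA.card_pos
  have hK1 : 1 ≤ K := by
    have : (A.card : ℝ) ≤ (A + S).card := by exact_mod_cast Finset.card_le_card_add_right hS
    by_contra h
    nlinarith
  have hL1 : 1 ≤ L := by
    have : (S.card : ℝ) ≤ (S + T).card := by exact_mod_cast Finset.card_le_card_add_right hT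
    by_contra h
    nlinarith
  have hlog2 : 0.69 < Real.log 2 := by have := Real.log_two_gt_d9; linarith
  have hlK : Real.log 2 ≤ Real.log (2 * K) := Real.log_le_log (by norm_num) (by linarith)
  have hlL : Real.log 2 ≤ Real.log (2 * L) := Real.log_le_log (by norm_num) (by linarith)
  set q := ⌈Real.log (2 * K)⌉₊ with hqdef
  have hq : 1 ≤ q := Nat.one_le_iff_ne_zero.2 (by
    rw [hqdef, Ne, Nat.ceil_eq_zero, not_le]; linarith)
  have hq1 : Real.log (2 * K) ≤ q := Nat.le_ceil _
  have hq2 : (q : ℝ) ≤ 3 * Real.log (2 * K) := by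
    have := Nat.ceil_lt_add_one (a := Real.log (2 * K)) (by linarith)
    linarith
  set k := 256 * q * m ^ 2 with hkdef
  have hk : 1 ≤ k := by
    have : 0 < k := by positivity
    omega
  have hkR : (k : ℝ) = 256 * q * (m : ℝ) ^ 2 := by rw [hkdef]; push_cast; ring
  have hmR : (1 : ℝ) ≤ m := by exact_mod_cast hm
  have hqR : (1 : ℝ) ≤ q := by exact_mod_cast hq
  have hkR1 : (1 : ℝ) ≤ k := by exact_mod_cast hk
  have hnum : (8 * Real.exp 1 * q * k * (m : ℝ) ^ 2) ^ q * (4 * K) < (k : ℝ) ^ (2 * q) := by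
    have e1 : (k : ℝ) ^ (2 * q) = (8 * q * k * (m : ℝ) ^ 2) ^ q * 32 ^ q := by
      rw [pow_mul, ← mul_pow]; congr 1
      rw [sq]; nth_rewrite 1 [hkR]; ring
    have e2 : (8 * Real.exp 1 * q * k * (m : ℝ) ^ 2) ^ q * (4 * K) =
        (8 * q * k * (m : ℝ) ^ 2) ^ q * (Real.exp 1 ^ q * (4 * K)) := by
      rw [show 8 * Real.exp 1 * q * k * (m : ℝ) ^ 2 = 8 * q * k * (m : ℝ) ^ 2 * Real.exp 1 by ring,
        mul_pow]; ring
    rw [e1, e2]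
    have h2K : 2 * K ≤ Real.exp 1 ^ q := by
      rw [← Real.exp_nat_mul, mul_one]
      exact (Real.log_le_iff_le_exp (by linarith)).1 hq1
    have h4K : 4 * K ≤ (Real.exp 1 ^ q) ^ 2 := by nlinarith
    have h32 : Real.exp 1 ^ 3 < 32 := by
      calc Real.exp 1 ^ 3 < 3 ^ 3 := by
            gcongr
            exact Real.exp_one_lt_d9.trans (by norm_num)
        _ < 32 := by norm_num
    refine mul_lt_mul_of_pos_left ?_ (by positivity)
    calc Real.exp 1 ^ q * (4 * K) ≤ Real.exp 1 ^ q * (Real.exp 1 ^ q) ^ 2 := by gcongr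
      _ = (Real.exp 1 ^ 3) ^ q := by ring
      _ < 32 ^ q := pow_lt_pow_left₀ h32 (by positivity) (by omega)
  obtain ⟨X, h0, hneg, hcard, hsub⟩ := core A S T hA hS hT K L m k q hm hk hq hK hL hnum
  refine ⟨X, h0, ?_, ?_, hsub⟩
  · rw [← Finset.coe_neg, ← hneg]
  rw [haar_coe, haar_coe, mul_div_assoc', div_le_div_iff_of_pos_right hGpos]
  have hkey : 2 * L ^ k ≤ Real.exp (768 * (m : ℝ) ^ 2 * Real.log (2 * K) * Real.log (2 * L)) := by
    calc 2 * L ^ k ≤ 2 ^ k * L ^ k := by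
          gcongr
          exact le_self_pow₀ (by norm_num) (by omega)
      _ = Real.exp (k * Real.log (2 * L)) := by
          rw [← mul_pow, Real.exp_nat_mul, Real.exp_log (by linarith)]
      _ ≤ _ := by
          apply Real.exp_le_exp.2
          refine mul_le_mul_of_nonneg_right ?_ (by linarith)
          rw [hkR]
          nlinarith [mul_le_mul_of_nonneg_right hq2 (by positivity : 0 ≤ 256 * (m : ℝ) ^ 2)]
  rw [Real.exp_neg, inv_mul_le_iff₀ (Real.exp_pos _)]
  exact hcard.trans (mul_le_mul_of_nonneg_right hkey (Nat.cast_nonneg _))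

end Paper
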